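/- arXiv:2410.06778 — 9 statements merged into one kernel-verified Lean document; each statement's English description precedes it below -/
import Mathlib

section
/- Let kappa >= 1 and S = {0, 1, ..., kappa}. For any interaction phi on S, the completion hat-phi of phi contains the multi-species exclusion interaction phi_ms^kappa. Moreover, if dim_R Consv^phi(S) = kappa, then phi is equivalent to phi_ms^kappa. -/
open Relation

universe u

/-- An interaction on `S`: a symmetric set of directed edges on the vertex set `S × S`. -/
def IsInteraction {S : Type*} (φ : Set ((S × S) × (S × S))) : Prop :=
  ∀ p ∈ φ, (p.2, p.1) ∈ φ

/-- A conserved quantity for the interaction `φ`. -/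
def IsConserved {S : Type*} (φ : Set ((S × S) × (S × S))) (ξ : S → ℝ) : Prop :=
  ∀ p ∈ φ, ξ p.1.1 + ξ p.1.2 = ξ p.2.1 + ξ p.2.2

/-- `ξ_S (s1, s2) = ξ s1 + ξ s2`. -/
def pairSum {S : Type*} (ξ : S → ℝ) (p : S × S) : ℝ := ξ p.1 + ξ p.2

/-- A symmetric directed graph structure on `X` given by its set of edges. -/
def IsSymmGraph {X : Type*} (E : Set (X × X)) : Prop := ∀ p ∈ E, (p.2, p.1) ∈ E

/-- Two vertices lie in the same connected component of the graph with edge set `E`. -/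
def graphConn {X : Type*} (E : Set (X × X)) : X → X → Prop :=
  Relation.ReflTransGen (fun a b => (a, b) ∈ E)

/-- A constant real-valued function. -/
def IsConstFn {S : Type*} (ξ : S → ℝ) : Prop := ∀ a b, ξ a = ξ b

/-- The submodule of `S → ℝ` consisting of conserved quantities of `φ`. -/
def consvSubmodule {S : Type*} (φ : Set ((S × S) × (S × S))) : Submodule ℝ (S → ℝ) where
  carrier := {ξ | IsConserved φ ξ}
  add_mem' := by
    intro a b ha hb p hp
    have h1 := ha p hp
    have h2 := hb p hp
    simp only [Pi.add_apply]
    linarith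
  zero_mem' := by
    intro p hp
    simp
  smul_mem' := by
    intro c a ha p hp
    simp only [Pi.smul_apply, smul_eq_mul]
    rw [← mul_add, ← mul_add, ha p hp]

/-- The submodule of constant functions. -/
def constSubmodule (S : Type*) : Submodule ℝ (S → ℝ) where
  carrier := {ξ | IsConstFn ξ}
  add_mem' := by
    intro a b ha hb x y
    simp only [Pi.add_apply]
    rw [ha x y, hb x y]
  zero_mem' := by intro x y; rfl
  smul_mem' := by
    intro c a ha x y
    simp only [Pi.smul_apply]
    rw [ha x y]

/-- `Consv^φ(S)`: conserved quantities modulo constant functions. -/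
abbrev ConsvQuot {S : Type*} (φ : Set ((S × S) × (S × S))) :=
  (consvSubmodule φ) ⧸ ((constSubmodule S).comap (consvSubmodule φ).subtype)

/-- `c_φ`, the dimension of `Consv^φ(S)`. -/
noncomputable def cdim {S : Type*} (φ : Set ((S × S) × (S × S))) : ℕ :=
  Module.finrank ℝ (ConsvQuot φ)

/-- Equivalence of interactions: a bijection of the sets of local states whose pullback
induces an isomorphism of the spaces of conserved quantities modulo constants. -/
def InteractionEquiv {S : Type*} {S' : Type*} (φ : Set ((S × S) × (S × S)))
    (φ' : Set ((S' × S') × (S' × S'))) : Prop :=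
  ∃ e : S ≃ S',
    (∀ ξ : S' → ℝ, IsConserved φ' ξ → IsConserved φ (fun s => ξ (e s))) ∧
    (∀ ξ : S → ℝ, IsConserved φ ξ → IsConserved φ' (fun s' => ξ (e.symm s')))

/-- Weak equivalence of interactions via a given map `ι : S → S'` : there is `ι' : S' → S`
such that the pullbacks along `ι` and `ι'` induce mutually inverse isomorphisms of the
spaces of conserved quantities modulo constants. -/
def WeakEquivVia {S : Type*} {S' : Type*} (φ : Set ((S × S) × (S × S)))
    (φ' : Set ((S' × S') × (S' × S'))) (ι : S → S') : Prop :=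
  ∃ ι' : S' → S,
    (∀ ξ : S' → ℝ, IsConserved φ' ξ → IsConserved φ (fun s => ξ (ι s))) ∧
    (∀ ξ : S → ℝ, IsConserved φ ξ → IsConserved φ' (fun s' => ξ (ι' s'))) ∧
    (∀ ξ : S → ℝ, IsConserved φ ξ → ∃ c : ℝ, ∀ s, ξ (ι' (ι s)) = ξ s + c) ∧
    (∀ ξ : S' → ℝ, IsConserved φ' ξ → ∃ c : ℝ, ∀ s', ξ (ι (ι' s')) = ξ s' + c)

/-- Weak equivalence of interactions. -/
def WeakEquiv {S : Type*} {S' : Type*} (φ : Set ((S × S) × (S × S)))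
    (φ' : Set ((S' × S') × (S' × S'))) : Prop :=
  ∃ ι : S → S', WeakEquivVia φ φ' ι

/-- Separability: distinct local states are distinguished by some conserved quantity. -/
def SeparableInteraction {S : Type*} (φ : Set ((S × S) × (S × S))) : Prop :=
  ∀ s s' : S, s ≠ s' → ∃ ξ : S → ℝ, IsConserved φ ξ ∧ ξ s ≠ ξ s'

/-- Exchangeability: `(s1, s2)` and `(s2, s1)` always lie in the same connected component. -/
def ExchangeableInteraction {S : Type*} (φ : Set ((S × S) × (S × S))) : Prop :=
  ∀ s1 s2 : S, graphConn φ (s1, s2) (s2, s1)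

/-- The completion of an interaction: connect all pairs of vertices on which every
conserved quantity takes equal values. -/
def interactionCompletion {S : Type*} (φ : Set ((S × S) × (S × S))) :
    Set ((S × S) × (S × S)) :=
  {q | ∀ ξ : S → ℝ, IsConserved φ ξ → pairSum ξ q.1 = pairSum ξ q.2}

/-- The edges of the configuration space with transition structure of `(S, φ)` on `(X, E)`. -/
def configEdge {S X : Type*} (φ : Set ((S × S) × (S × S))) (E : Set (X × X)) :
    Set ((X → S) × (X → S)) :=
  {q | ∃ e ∈ E, ((q.1 e.1, q.1 e.2), (q.2 e.1, q.2 e.2)) ∈ φ ∧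
        ∀ z, z ≠ e.1 → z ≠ e.2 → q.1 z = q.2 z}

/-- Same connected component in the configuration space with transition structure. -/
def configConn {S X : Type*} (φ : Set ((S × S) × (S × S))) (E : Set (X × X)) :
    (X → S) → (X → S) → Prop :=
  graphConn (configEdge φ E)

/-- The interaction `(S, φ)` is irreducibly quantified. -/
def IrreduciblyQuantified {S : Type*} (φ : Set ((S × S) × (S × S))) : Prop :=
  ∀ (X : Type) [Fintype X] (E : Set (X × X)), IsSymmGraph E →
    (∀ x y : X, graphConn E x y) →
    ∀ η η' : X → S,
      (∀ ξ : S → ℝ, IsConserved φ ξ → ∑ x, ξ (η x) = ∑ x, ξ (η' x)) →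
      configConn φ E η η'

/-- The relation identifying the two base points in `S1 ⊕ S2`. -/
def wedgeRel {S1 : Type*} {S2 : Type*} (p1 : S1) (p2 : S2) :
    (S1 ⊕ S2) → (S1 ⊕ S2) → Prop :=
  fun a b => (a = Sum.inl p1 ∧ b = Sum.inr p2) ∨ (a = Sum.inr p2 ∧ b = Sum.inl p1)

/-- The wedge sum `S1 ∨ S2` along base points `p1` and `p2`. -/
def WedgeSum {S1 : Type*} {S2 : Type*} (p1 : S1) (p2 : S2) := Quot (wedgeRel p1 p2)

/-- Inclusion of `S1` into the wedge sum. -/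
def wedgeInl {S1 : Type*} {S2 : Type*} (p1 : S1) (p2 : S2) (s : S1) : WedgeSum p1 p2 :=
  Quot.mk _ (Sum.inl s)

/-- Inclusion of `S2` into the wedge sum. -/
def wedgeInr {S1 : Type*} {S2 : Type*} (p1 : S1) (p2 : S2) (s : S2) : WedgeSum p1 p2 :=
  Quot.mk _ (Sum.inr s)

/-- The wedge sum `φ1 ∨ φ2` of two interactions: all edges of `φ1`, all edges of `φ2`,
and the transposition edges `(s, s') ↔ (s', s)` for `s ∈ S1`, `s' ∈ S2`. -/
def wedgeInteraction {S1 : Type*} {S2 : Type*} (φ1 : Set ((S1 × S1) × (S1 × S1)))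
    (φ2 : Set ((S2 × S2) × (S2 × S2))) (p1 : S1) (p2 : S2) :
    Set ((WedgeSum p1 p2 × WedgeSum p1 p2) × (WedgeSum p1 p2 × WedgeSum p1 p2)) :=
  {q | (∃ r ∈ φ1, q = ((wedgeInl p1 p2 r.1.1, wedgeInl p1 p2 r.1.2),
          (wedgeInl p1 p2 r.2.1, wedgeInl p1 p2 r.2.2))) ∨
       (∃ r ∈ φ2, q = ((wedgeInr p1 p2 r.1.1, wedgeInr p1 p2 r.1.2),
          (wedgeInr p1 p2 r.2.1, wedgeInr p1 p2 r.2.2))) ∨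
       (∃ (s : S1) (s' : S2), q = ((wedgeInl p1 p2 s, wedgeInr p1 p2 s'),
          (wedgeInr p1 p2 s', wedgeInl p1 p2 s))) ∨
       (∃ (s : S1) (s' : S2), q = ((wedgeInr p1 p2 s', wedgeInl p1 p2 s),
          (wedgeInl p1 p2 s, wedgeInr p1 p2 s')))}

/-- The box product `φ1 □ φ2` of two interactions, on `S1 × S2`. -/
def boxProd {S1 : Type*} {S2 : Type*} (φ1 : Set ((S1 × S1) × (S1 × S1)))
    (φ2 : Set ((S2 × S2) × (S2 × S2))) :
    Set (((S1 × S2) × (S1 × S2)) × ((S1 × S2) × (S1 × S2))) :=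
  {q | (q.1.1.1 = q.2.1.1 ∧ q.1.2.1 = q.2.2.1 ∧
          ((q.1.1.2, q.1.2.2), (q.2.1.2, q.2.2.2)) ∈ φ2) ∨
       (q.1.1.2 = q.2.1.2 ∧ q.1.2.2 = q.2.2.2 ∧
          ((q.1.1.1, q.1.2.1), (q.2.1.1, q.2.2.1)) ∈ φ1)}

/-- The `κ`-exclusion interaction on `{0, …, κ}`: edges `(j, k) ↔ (j-1, k+1)` for
`0 < j ≤ κ`, `0 ≤ k < κ`.  `exclK 1` is the exclusion interaction `φ_EX`. -/
def exclK (κ : ℕ) : Set ((Fin (κ + 1) × Fin (κ + 1)) × (Fin (κ + 1) × Fin (κ + 1))) :=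
  {q | ∃ j k : Fin (κ + 1), 0 < (j : ℕ) ∧ (k : ℕ) < κ ∧
        (q = ((j, k), (j - 1, k + 1)) ∨ q = ((j - 1, k + 1), (j, k)))}

/-- The multi-species exclusion interaction `φ_ms^κ` on `{0, …, κ}`. -/
def msExcl (κ : ℕ) : Set ((Fin (κ + 1) × Fin (κ + 1)) × (Fin (κ + 1) × Fin (κ + 1))) :=
  {q | ∃ j k : Fin (κ + 1), j ≠ k ∧ q = ((j, k), (k, j))}

/-- The lattice gas with energy interaction `φ_{κ-LGE}` on `{0, …, κ}`:
edges `(j, k) ↔ (j-1, k+1)` for `j ≥ 2`, `k < κ`, together with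
edges `(j, k) ↔ (k, j)` for `j ∈ {0, 1}`, `k ∈ S`, `j ≠ k`. -/
def lge (κ : ℕ) : Set ((Fin (κ + 1) × Fin (κ + 1)) × (Fin (κ + 1) × Fin (κ + 1))) :=
  {q | (∃ j k : Fin (κ + 1), 2 ≤ (j : ℕ) ∧ (k : ℕ) < κ ∧
          (q = ((j, k), (j - 1, k + 1)) ∨ q = ((j - 1, k + 1), (j, k)))) ∨
       (∃ j k : Fin (κ + 1), (j : ℕ) ≤ 1 ∧ j ≠ k ∧
          (q = ((j, k), (k, j)) ∨ q = ((k, j), (j, k))))}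

/-- The Glauber interaction on `{0, 1}`: all four vertices of the graph are connected
into a single component. -/
def glauber : Set ((Fin 2 × Fin 2) × (Fin 2 × Fin 2)) := Set.univ

/-- The standard conserved quantities `ξ^i` on `{0, …, κ}`: `ξ^i (j) = δ_{ij}`. -/
noncomputable def stdXi (κ : ℕ) (i : Fin (κ + 1)) : Fin (κ + 1) → ℝ := fun t => if t = i then 1 else 0

/-- The identification `{0,1,2,3} ≅ {0,1} × {0,1}`, `0 ↦ (0,0)`, `1 ↦ (1,0)`,
`2 ↦ (0,1)`, `3 ↦ (1,1)`. -/
def identF : Fin 4 → Fin 2 × Fin 2 := ![(0, 0), (1, 0), (0, 1), (1, 1)]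

/-- The two-lane exclusion interaction `φ_EX □ φ_EX` on `{0,1,2,3}` under the
identification `identF`. -/
def twoLane : Set ((Fin 4 × Fin 4) × (Fin 4 × Fin 4)) :=
  {q | ((identF q.1.1, identF q.1.2), (identF q.2.1, identF q.2.2)) ∈ boxProd (exclK 1) (exclK 1)}

/-- The `N`-lane `κ`-exclusion interaction, i.e. the `N`-fold box product of the
`κ`-exclusion interaction, on `{0, …, κ}^N`. -/
def nLane (κ N : ℕ) :
    Set (((Fin N → Fin (κ + 1)) × (Fin N → Fin (κ + 1))) ×
         ((Fin N → Fin (κ + 1)) × (Fin N → Fin (κ + 1)))) :=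
  {q | ∃ i : Fin N, (∀ j : Fin N, j ≠ i → q.1.1 j = q.2.1 j ∧ q.1.2 j = q.2.2 j) ∧
        ((q.1.1 i, q.1.2 i), (q.2.1 i, q.2.2 i)) ∈ exclK κ}

/-- The "new interaction" of the paper: the lattice gas with energy `φ_{3-LGE}` together
with the two edges `(1,1) ↔ (0,3)`. -/
def newInt : Set ((Fin 4 × Fin 4) × (Fin 4 × Fin 4)) :=
  lge 3 ∪ {(((1 : Fin 4), (1 : Fin 4)), ((0 : Fin 4), (3 : Fin 4))),
           (((0 : Fin 4), (3 : Fin 4)), ((1 : Fin 4), (1 : Fin 4)))}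

/-- The modified basis `tilde-ξ^i` of Lemma "prop: less". -/
noncomputable def tiltedBasis {S : Type*} {c : ℕ} (xi : Fin c → S → ℝ) (k : Fin c) (s s' : S × S) :
    Fin c → S → ℝ :=
  fun i t => xi i t -
    ((pairSum (xi i) s' - pairSum (xi i) s) / (pairSum (xi k) s' - pairSum (xi k) s)) * xi k t


/-- for any interaction `φ` on `S = {0, …, κ}`, the completion of `φ`
contains the multi-species exclusion interaction; and if `c_φ = κ` then `φ` is equivalent
to the multi-species exclusion interaction. -/
theorem stmt2 (κ : ℕ) (hκ : 1 ≤ κ)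
    (φ : Set ((Fin (κ + 1) × Fin (κ + 1)) × (Fin (κ + 1) × Fin (κ + 1))))
    (hφ : IsInteraction φ) :
    msExcl κ ⊆ interactionCompletion φ ∧
    (cdim φ = κ → InteractionEquiv φ (msExcl κ)) := by
  constructor
  · rintro q ⟨j, k, -, rfl⟩ ξ -
    simp only [pairSum]
    ring
  · intro h
    have h1 := Submodule.finrank_quotient_add_finrank
      ((constSubmodule (Fin (κ + 1))).comap (consvSubmodule φ).subtype)
    have hone : (fun _ => (1 : ℝ)) ∈ consvSubmodule φ := by
      intro p _
      rfl
    have hne : (constSubmodule (Fin (κ + 1))).comap (consvSubmodule φ).subtype ≠ ⊥ := by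
      rw [Submodule.ne_bot_iff]
      refine ⟨⟨_, hone⟩, fun a b => rfl, ?_⟩
      intro h0
      have := congrFun (congrArg Subtype.val h0) 0
      simp at this
    have h2 := Submodule.one_le_finrank_iff.mpr hne
    have h3 : Module.finrank ℝ (consvSubmodule φ) ≤ Module.finrank ℝ (Fin (κ + 1) → ℝ) :=
      Submodule.finrank_le _
    have h4 : consvSubmodule φ = ⊤ := by
      apply Submodule.eq_top_of_finrank_eq
      unfold cdim at h
      simp only [Module.finrank_fin_fun] at h3 ⊢
      unfold ConsvQuot at h
      omega
    refine ⟨Equiv.refl _, ?_, ?_⟩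
    · intro ξ _
      have : ξ ∈ consvSubmodule φ := h4 ▸ Submodule.mem_top
      exact this
    · rintro ξ - q ⟨j, k, -, rfl⟩
      exact add_comm _ _
end

section
/- Let (S1, phi1) and (S2, phi2) be interactions, let *1 in S1 and *2 in S2, and form the wedge sum (S1 v S2, phi1 v phi2) along *1 and *2. Then Consv^{phi1 v phi2}(S1 v S2) is canonically isomorphic to the direct sum Consv^{phi1}(S1) + Consv^{phi2}(S2); in particular c_{phi1 v phi2} = c_{phi1} + c_{phi2} when these dimensions are finite. -/
open Relation

universe u

/-- `Consv^{φ1 ∨ φ2}(S1 ∨ S2) ≅ Consv^{φ1}(S1) ⊕ Consv^{φ2}(S2)`,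
and `c_{φ1 ∨ φ2} = c_{φ1} + c_{φ2}` when the dimensions are finite. -/
theorem stmt3 {S1 S2 : Type*} (φ1 : Set ((S1 × S1) × (S1 × S1)))
    (φ2 : Set ((S2 × S2) × (S2 × S2))) (h1 : IsInteraction φ1) (h2 : IsInteraction φ2)
    (p1 : S1) (p2 : S2) :
    (∀ ξ : WedgeSum p1 p2 → ℝ, IsConserved (wedgeInteraction φ1 φ2 p1 p2) ξ →
      IsConserved φ1 (fun s => ξ (wedgeInl p1 p2 s)) ∧
      IsConserved φ2 (fun s => ξ (wedgeInr p1 p2 s))) ∧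
    (∀ (ξ1 : S1 → ℝ) (ξ2 : S2 → ℝ), IsConserved φ1 ξ1 → IsConserved φ2 ξ2 →
      ∃ ξ : WedgeSum p1 p2 → ℝ, IsConserved (wedgeInteraction φ1 φ2 p1 p2) ξ ∧
        (∃ c1 : ℝ, ∀ s, ξ (wedgeInl p1 p2 s) = ξ1 s + c1) ∧
        (∃ c2 : ℝ, ∀ s, ξ (wedgeInr p1 p2 s) = ξ2 s + c2)) ∧
    (∀ ξ : WedgeSum p1 p2 → ℝ, IsConserved (wedgeInteraction φ1 φ2 p1 p2) ξ →
      IsConstFn (fun s => ξ (wedgeInl p1 p2 s)) →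
      IsConstFn (fun s => ξ (wedgeInr p1 p2 s)) → IsConstFn ξ) ∧
    (FiniteDimensional ℝ (ConsvQuot φ1) → FiniteDimensional ℝ (ConsvQuot φ2) →
      cdim (wedgeInteraction φ1 φ2 p1 p2) = cdim φ1 + cdim φ2) := by
  have A : ∀ ξ : WedgeSum p1 p2 → ℝ, IsConserved (wedgeInteraction φ1 φ2 p1 p2) ξ →
      IsConserved φ1 (fun s => ξ (wedgeInl p1 p2 s)) ∧
      IsConserved φ2 (fun s => ξ (wedgeInr p1 p2 s)) := by
    intro ξ h
    refine ⟨fun r hr => ?_, fun r hr => ?_⟩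
    · exact h _ (Or.inl ⟨r, hr, rfl⟩)
    · exact h _ (Or.inr (Or.inl ⟨r, hr, rfl⟩))
  have B : ∀ (ξ1 : S1 → ℝ) (ξ2 : S2 → ℝ), IsConserved φ1 ξ1 → IsConserved φ2 ξ2 →
      ∃ ξ : WedgeSum p1 p2 → ℝ, IsConserved (wedgeInteraction φ1 φ2 p1 p2) ξ ∧
        (∃ c1 : ℝ, ∀ s, ξ (wedgeInl p1 p2 s) = ξ1 s + c1) ∧
        (∃ c2 : ℝ, ∀ s, ξ (wedgeInr p1 p2 s) = ξ2 s + c2) := by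
    intro ξ1 ξ2 H1 H2
    let ξ : WedgeSum p1 p2 → ℝ := Quot.lift
      (Sum.elim (fun s => ξ1 s + -ξ1 p1) (fun s => ξ2 s + -ξ2 p2)) (by
        rintro a b (⟨rfl, rfl⟩ | ⟨rfl, rfl⟩) <;> simp)
    have e1 : ∀ s, ξ (wedgeInl p1 p2 s) = ξ1 s + -ξ1 p1 := fun s => rfl
    have e2 : ∀ s, ξ (wedgeInr p1 p2 s) = ξ2 s + -ξ2 p2 := fun s => rfl
    refine ⟨ξ, ?_, ⟨_, e1⟩, ⟨_, e2⟩⟩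
    rintro q (⟨r, hr, rfl⟩ | ⟨r, hr, rfl⟩ | ⟨s, s', rfl⟩ | ⟨s, s', rfl⟩)
    · have := H1 r hr
      simp only [e1]
      linarith
    · have := H2 r hr
      simp only [e2]
      linarith
    · exact add_comm _ _
    · exact add_comm _ _
  have C : ∀ ξ : WedgeSum p1 p2 → ℝ, IsConserved (wedgeInteraction φ1 φ2 p1 p2) ξ →
      IsConstFn (fun s => ξ (wedgeInl p1 p2 s)) →
      IsConstFn (fun s => ξ (wedgeInr p1 p2 s)) → IsConstFn ξ := by
    intro ξ _ H1 H2
    have hp : wedgeInl p1 p2 p1 = wedgeInr p1 p2 p2 := Quot.sound (Or.inl ⟨rfl, rfl⟩)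
    have key : ∀ a, ξ a = ξ (wedgeInl p1 p2 p1) := by
      rintro ⟨s | s⟩
      · exact H1 s p1
      · rw [hp]
        exact H2 s p2
    intro a b
    rw [key a, key b]
  refine ⟨A, B, C, ?_⟩
  intro f1 f2
  let φ := wedgeInteraction φ1 φ2 p1 p2
  let F1 : consvSubmodule φ →ₗ[ℝ] consvSubmodule φ1 :=
    { toFun := fun ξ => ⟨fun s => ξ.1 (wedgeInl p1 p2 s), (A ξ.1 ξ.2).1⟩
      map_add' := fun _ _ => rfl
      map_smul' := fun _ _ => rfl }
  let F2 : consvSubmodule φ →ₗ[ℝ] consvSubmodule φ2 :=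
    { toFun := fun ξ => ⟨fun s => ξ.1 (wedgeInr p1 p2 s), (A ξ.1 ξ.2).2⟩
      map_add' := fun _ _ => rfl
      map_smul' := fun _ _ => rfl }
  let N1 := (constSubmodule S1).comap (consvSubmodule φ1).subtype
  let N2 := (constSubmodule S2).comap (consvSubmodule φ2).subtype
  let N := (constSubmodule (WedgeSum p1 p2)).comap (consvSubmodule φ).subtype
  let F : consvSubmodule φ →ₗ[ℝ] (ConsvQuot φ1 × ConsvQuot φ2) :=
    (N1.mkQ.comp F1).prod (N2.mkQ.comp F2)
  have hsurj : Function.Surjective F := by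
    rintro ⟨x, y⟩
    obtain ⟨⟨x, hx⟩, rfl⟩ := N1.mkQ_surjective x
    obtain ⟨⟨y, hy⟩, rfl⟩ := N2.mkQ_surjective y
    obtain ⟨ξ, hξ, ⟨c1, e1⟩, ⟨c2, e2⟩⟩ := B x y hx hy
    refine ⟨⟨ξ, hξ⟩, Prod.ext ?_ ?_⟩
    · refine (Submodule.Quotient.eq N1).2 ?_
      intro a b
      change ξ (wedgeInl p1 p2 a) - x a = ξ (wedgeInl p1 p2 b) - x b
      rw [e1, e1]
      ring
    · refine (Submodule.Quotient.eq N2).2 ?_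
      intro a b
      change ξ (wedgeInr p1 p2 a) - y a = ξ (wedgeInr p1 p2 b) - y b
      rw [e2, e2]
      ring
  have hker : N = LinearMap.ker F := by
    ext ξ
    rw [LinearMap.mem_ker]
    constructor
    · intro h
      refine Prod.ext ?_ ?_
      · exact (Submodule.Quotient.mk_eq_zero N1).2 (fun a b => h _ _)
      · exact (Submodule.Quotient.mk_eq_zero N2).2 (fun a b => h _ _)
    · intro h
      have g1 : F1 ξ ∈ N1 := (Submodule.Quotient.mk_eq_zero N1).1 (congrArg Prod.fst h)
      have g2 : F2 ξ ∈ N2 := (Submodule.Quotient.mk_eq_zero N2).1 (congrArg Prod.snd h)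
      exact C ξ.1 ξ.2 g1 g2
  have e : ConsvQuot φ ≃ₗ[ℝ] (ConsvQuot φ1 × ConsvQuot φ2) :=
    (Submodule.quotEquivOfEq N _ hker).trans (F.quotKerEquivOfSurjective hsurj)
  have := e.finrank_eq
  rw [Module.finrank_prod] at this
  exact this
end

section
/- Let S be a finite set and (S, phi) an interaction. Suppose s, s' in S x S are such that there exists a conserved quantity xi of phi with xi_S(s) != xi_S(s'). Let tilde-phi = phi together with the two edges (s, s') and (s', s). Then tilde-phi is an interaction on S containing phi with dim_R Consv^{tilde-phi}(S) = dim_R Consv^phi(S) - 1. Moreover, if xi^1, ..., xi^c is a basis of Consv^phi(S) and k is an index with xi^k_S(s) != xi^k_S(s'), then the classes of tilde-xi^i = xi^i - ((xi^i_S(s') - xi^i_S(s)) / (xi^k_S(s') - xi^k_S(s))) * xi^k, for i != k, form a basis of Consv^{tilde-phi}(S). -/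
open Relation

universe u

theorem aux_cons {S : Type*} (φ : Set ((S × S) × (S × S))) (s s' : S × S) (ξ : S → ℝ) :
    IsConserved (φ ∪ {(s, s'), (s', s)}) ξ ↔ IsConserved φ ξ ∧ pairSum ξ s = pairSum ξ s' := by
  constructor
  · intro h
    exact ⟨fun p hp => h p (Or.inl hp), h (s, s') (by simp)⟩
  · rintro ⟨h, h2⟩ p hp
    rcases hp with hp | hp | hp
    · exact h p hp
    · subst hp; exact h2
    · rw [Set.mem_singleton_iff] at hp
      subst hp; exact h2.symm

theorem aux_const {S : Type*} (φ : Set ((S × S) × (S × S))) :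
    constSubmodule S ≤ consvSubmodule φ := by
  intro ξ h p _
  rw [h p.1.1 p.2.1, h p.1.2 p.2.2]

theorem aux_dim {S : Type*} [Fintype S] (φ : Set ((S × S) × (S × S))) :
    cdim φ + Module.finrank ℝ (constSubmodule S) = Module.finrank ℝ (consvSubmodule φ) := by
  rw [← Submodule.finrank_quotient_add_finrank
    ((constSubmodule S).comap (consvSubmodule φ).subtype),
    (Submodule.comapSubtypeEquivOfLe (aux_const φ)).finrank_eq]
  rfl

/-- The functional measuring the difference of pair sums. -/
def auxF {S : Type*} (s s' : S × S) : (S → ℝ) →ₗ[ℝ] ℝ where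
  toFun ξ := pairSum ξ s - pairSum ξ s'
  map_add' a b := by simp only [pairSum, Pi.add_apply]; ring
  map_smul' a b := by simp only [pairSum, Pi.smul_apply, smul_eq_mul, RingHom.id_apply]; ring

theorem aux_drop {S : Type*} [Fintype S] (φ : Set ((S × S) × (S × S))) (s s' : S × S)
    (hsep : ∃ ξ : S → ℝ, IsConserved φ ξ ∧ pairSum ξ s ≠ pairSum ξ s') :
    Module.finrank ℝ (consvSubmodule (φ ∪ {(s, s'), (s', s)})) + 1
      = Module.finrank ℝ (consvSubmodule φ) := by
  have hle : consvSubmodule (φ ∪ {(s, s'), (s', s)}) ≤ consvSubmodule φ :=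
    fun ξ h => ((aux_cons φ s s' ξ).1 h).1
  set f := (auxF s s').comp (consvSubmodule φ).subtype with hf
  have hk : (consvSubmodule (φ ∪ {(s, s'), (s', s)})).comap (consvSubmodule φ).subtype
      = LinearMap.ker f := by
    ext ⟨ξ, h⟩
    constructor
    · intro h'
      exact sub_eq_zero.2 ((aux_cons φ s s' ξ).1 h').2
    · intro h'
      exact (aux_cons φ s s' ξ).2 ⟨h, sub_eq_zero.1 h'⟩
  have hr : LinearMap.range f = ⊤ := by
    rw [LinearMap.range_eq_top]
    apply LinearMap.surjective
    obtain ⟨ξ, h, hne⟩ := hsep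
    intro h0
    have := LinearMap.congr_fun h0 ⟨ξ, h⟩
    exact hne (sub_eq_zero.1 this)
  have := LinearMap.finrank_range_add_finrank_ker f
  rw [← hk, (Submodule.comapSubtypeEquivOfLe hle).finrank_eq, hr, finrank_top,
    Module.finrank_self] at this
  omega

theorem aux_sum {S : Type*} {c : ℕ} (xi : Fin c → S → ℝ) (k : Fin c) (s s' : S × S)
    (a : Fin c → ℝ) (t : S) :
    ∑ i, a i * tiltedBasis xi k s s' i t = ∑ i, a i * xi i t -
      (∑ i, a i * ((pairSum (xi i) s' - pairSum (xi i) s) /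
        (pairSum (xi k) s' - pairSum (xi k) s))) * xi k t := by
  rw [Finset.sum_mul, ← Finset.sum_sub_distrib]
  refine Finset.sum_congr rfl fun i _ => ?_
  simp only [tiltedBasis]; ring

/-- connecting two vertices separated by some conserved quantity drops the
dimension of the space of conserved quantities by exactly one, with an explicit basis. -/
theorem stmt6 {S : Type*} [Fintype S] [Nonempty S] (φ : Set ((S × S) × (S × S)))
    (hφ : IsInteraction φ) (s s' : S × S)
    (hsep : ∃ ξ : S → ℝ, IsConserved φ ξ ∧ pairSum ξ s ≠ pairSum ξ s') :
    IsInteraction (φ ∪ {(s, s'), (s', s)}) ∧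
    φ ⊆ φ ∪ {(s, s'), (s', s)} ∧
    cdim (φ ∪ {(s, s'), (s', s)}) = cdim φ - 1 ∧
    (∀ xi : Fin (cdim φ) → S → ℝ,
      (∀ i, IsConserved φ (xi i)) →
      (∀ a : Fin (cdim φ) → ℝ, IsConstFn (fun t => ∑ i, a i * xi i t) → ∀ i, a i = 0) →
      (∀ ξ : S → ℝ, IsConserved φ ξ →
        ∃ (a : Fin (cdim φ) → ℝ) (d : ℝ), ∀ t, ξ t = (∑ i, a i * xi i t) + d) →
      ∀ k : Fin (cdim φ), pairSum (xi k) s ≠ pairSum (xi k) s' →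
        (∀ i, i ≠ k → IsConserved (φ ∪ {(s, s'), (s', s)}) (tiltedBasis xi k s s' i)) ∧
        (∀ a : Fin (cdim φ) → ℝ, a k = 0 →
          IsConstFn (fun t => ∑ i, a i * tiltedBasis xi k s s' i t) → ∀ i, a i = 0) ∧
        (∀ ξ : S → ℝ, IsConserved (φ ∪ {(s, s'), (s', s)}) ξ →
          ∃ (a : Fin (cdim φ) → ℝ) (d : ℝ), a k = 0 ∧
            ∀ t, ξ t = (∑ i, a i * tiltedBasis xi k s s' i t) + d)) := by
  refine ⟨?_, Set.subset_union_left, ?_, ?_⟩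
  · rintro p (hp | hp | hp)
    · exact Or.inl (hφ p hp)
    · subst hp; simp
    · rw [Set.mem_singleton_iff] at hp
      subst hp; simp
  · have h1 := aux_dim φ
    have h2 := aux_dim (φ ∪ {(s, s'), (s', s)})
    have h3 := aux_drop φ s s' hsep
    omega
  · intro xi hc hli hspan k hk
    have hD : pairSum (xi k) s' - pairSum (xi k) s ≠ 0 := sub_ne_zero.2 hk.symm
    refine ⟨?_, ?_, ?_⟩
    · intro i _
      rw [aux_cons]
      constructor
      · intro p hp
        have h1 := hc i p hp
        have h2 := hc k p hp
        simp only [tiltedBasis]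
        linear_combination h1 - ((pairSum (xi i) s' - pairSum (xi i) s) /
          (pairSum (xi k) s' - pairSum (xi k) s)) * h2
      · have h : (pairSum (xi i) s' - pairSum (xi i) s) /
          (pairSum (xi k) s' - pairSum (xi k) s) * (pairSum (xi k) s' - pairSum (xi k) s)
            = pairSum (xi i) s' - pairSum (xi i) s := div_mul_cancel₀ _ hD
        have e : ∀ p, pairSum (tiltedBasis xi k s s' i) p = pairSum (xi i) p -
          (pairSum (xi i) s' - pairSum (xi i) s) /
          (pairSum (xi k) s' - pairSum (xi k) s) * pairSum (xi k) p := by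
          intro p
          simp only [tiltedBasis, pairSum]; ring
        rw [e, e]
        linear_combination h
    · intro a hak hconst
      simp only [aux_sum] at hconst
      set R := ∑ i, a i * ((pairSum (xi i) s' - pairSum (xi i) s) /
        (pairSum (xi k) s' - pairSum (xi k) s))
      have h := hli (fun i => a i - if i = k then R else 0) (by
        have e : (fun t => ∑ i, (a i - if i = k then R else 0) * xi i t)
            = fun t => ∑ i, a i * xi i t - R * xi k t := by
          funext t
          simp [sub_mul, Finset.sum_sub_distrib, ite_mul]
        rw [e]; exact hconst)
      intro i
      by_cases hi : i = k
      · rw [hi, hak]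
      · simpa [hi] using h i
    · intro ξ hξ
      rw [aux_cons] at hξ
      obtain ⟨h1, h2⟩ := hξ
      obtain ⟨a, d, h⟩ := hspan ξ h1
      have e : ∀ p, pairSum ξ p = ∑ i, a i * pairSum (xi i) p + 2 * d := by
        intro p
        simp only [pairSum, h, mul_add, Finset.sum_add_distrib]; ring
      have hR : ∑ i, a i * ((pairSum (xi i) s' - pairSum (xi i) s) /
          (pairSum (xi k) s' - pairSum (xi k) s)) = 0 := by
        simp only [← mul_div_assoc]
        rw [← Finset.sum_div, div_eq_zero_iff]
        left
        simp only [mul_sub, Finset.sum_sub_distrib]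
        rw [e, e] at h2
        linarith
      refine ⟨Function.update a k 0, d, by simp, fun t => ?_⟩
      have h0 : tiltedBasis xi k s s' k t = 0 := by
        simp [tiltedBasis, div_self hD]
      have h3 : ∑ i, Function.update a k 0 i * tiltedBasis xi k s s' i t
          = ∑ i, a i * tiltedBasis xi k s s' i t := by
        refine Finset.sum_congr rfl fun i _ => ?_
        by_cases hi : i = k
        · subst hi; rw [h0]; simp
        · rw [Function.update_of_ne hi]
      rw [h3, aux_sum, hR, h t]; ring
end

section
/- Let S = {0, ..., kappa} and let phi_ms^kappa be the multi-species exclusion interaction on S, with standard basis xi^1, ..., xi^kappa of Consv^{phi_ms^kappa}(S) (xi^i(j) = delta_{ij}, xi^i(0) = 0). Let j, k in S with j, k != 0 and j != k, and let phi be an interaction containing phi_ms^kappa such that ((j, j), (k, k)) is an edge of phi and dim_R Consv^phi(S) = kappa - 1. Then the classes of the xi^i for i != j, k together with xi^j + xi^k form an R-linear basis of Consv^phi(S), and the interaction phi is not separable. -/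
open Relation

universe u

theorem consv_of_eq (κ : ℕ) (hκ : 1 ≤ κ) (j k : Fin (κ + 1)) (hjk : j ≠ k)
    (φ : Set ((Fin (κ + 1) × Fin (κ + 1)) × (Fin (κ + 1) × Fin (κ + 1))))
    (hedge : ((j, j), (k, k)) ∈ φ)
    (hdim : cdim φ = κ - 1) (ξ : Fin (κ + 1) → ℝ) (h : ξ j = ξ k) : IsConserved φ ξ := by
  let W : Submodule ℝ (Fin (κ + 1) → ℝ) :=
    LinearMap.ker (LinearMap.proj (R := ℝ) (φ := fun _ : Fin (κ + 1) => ℝ) j - LinearMap.proj k)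
  have hW : ∀ f, f ∈ W ↔ f j = f k := by
    intro f
    simp [W, sub_eq_zero]
  have hle : consvSubmodule φ ≤ W := by
    intro f hf
    rw [hW]
    have h1 : f j + f j = f k + f k := hf _ hedge
    linarith
  have hWlt : Module.finrank ℝ W < κ + 1 := by
    have h1 : W < ⊤ := by
      rw [lt_top_iff_ne_top]
      intro ht
      have h2 : (Pi.single j 1 : Fin (κ + 1) → ℝ) ∈ W := by rw [ht]; trivial
      rw [hW] at h2
      simp [Pi.single_apply, hjk.symm] at h2
    have h3 := Submodule.finrank_lt h1.ne
    simpa using h3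
  have hq := Submodule.finrank_quotient_add_finrank
    ((constSubmodule (Fin (κ + 1))).comap (consvSubmodule φ).subtype)
  have hpos : 0 < Module.finrank ℝ
      ((constSubmodule (Fin (κ + 1))).comap (consvSubmodule φ).subtype) := by
    rw [Nat.pos_iff_ne_zero, Ne, Submodule.finrank_eq_zero, ← Ne, Submodule.ne_bot_iff]
    refine ⟨⟨fun _ => 1, fun p _ => rfl⟩, fun _ _ => rfl, ?_⟩
    intro h0
    have h1 := congrFun (congrArg Subtype.val h0) j
    simp at h1
  have heq : consvSubmodule φ = W := by
    apply Submodule.eq_of_le_of_finrank_le hle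
    unfold cdim ConsvQuot at hdim
    omega
  have : ξ ∈ consvSubmodule φ := by rw [heq, hW]; exact h
  exact this

/-- for `φ ⊇ φ_ms^κ` with the edge `(j,j) ↔ (k,k)` (`j, k ≠ 0`, `j ≠ k`) and
`dim Consv^φ = κ - 1`, the classes of the `ξ^i` for `i ≠ j, k` together with `ξ^j + ξ^k`
form a basis of `Consv^φ(S)`, and `φ` is not separable. -/
theorem stmt7 (κ : ℕ) (hκ : 1 ≤ κ) (j k : Fin (κ + 1)) (hj : (j : ℕ) ≠ 0)
    (hk : (k : ℕ) ≠ 0) (hjk : j ≠ k)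
    (φ : Set ((Fin (κ + 1) × Fin (κ + 1)) × (Fin (κ + 1) × Fin (κ + 1))))
    (hφ : IsInteraction φ) (hms : msExcl κ ⊆ φ) (hedge : ((j, j), (k, k)) ∈ φ)
    (hdim : cdim φ = κ - 1) :
    (∀ i : Fin (κ + 1), (i : ℕ) ≠ 0 → i ≠ j → i ≠ k → IsConserved φ (stdXi κ i)) ∧
    IsConserved φ (fun t => stdXi κ j t + stdXi κ k t) ∧
    (∀ a : Fin (κ + 1) → ℝ, a 0 = 0 → a j = a k →
      IsConstFn (fun t => ∑ i, a i * stdXi κ i t) → ∀ i, a i = 0) ∧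
    (∀ ξ : Fin (κ + 1) → ℝ, IsConserved φ ξ →
      ∃ (a : Fin (κ + 1) → ℝ) (d : ℝ), a 0 = 0 ∧ a j = a k ∧
        ∀ t, ξ t = (∑ i, a i * stdXi κ i t) + d) ∧
    ¬ SeparableInteraction φ := by
  have hc := consv_of_eq κ hκ j k hjk φ hedge hdim
  have he : ∀ ξ : Fin (κ + 1) → ℝ, IsConserved φ ξ → ξ j = ξ k := by
    intro ξ hξ
    have h1 : ξ j + ξ j = ξ k + ξ k := hξ _ hedge
    linarith
  have hs : ∀ (a : Fin (κ + 1) → ℝ) t, ∑ i, a i * stdXi κ i t = a t := by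
    intro a t
    simp [stdXi]
  refine ⟨?_, ?_, ?_, ?_, ?_⟩
  · intro i _ hij hik
    apply hc
    simp [stdXi, hij.symm, hik.symm]
  · apply hc
    simp [stdXi, hjk, hjk.symm]
  · intro a h0 _ hconst i
    have h1 := hconst i 0
    simp only [hs] at h1
    rw [h1, h0]
  · intro ξ hξ
    refine ⟨fun t => ξ t - ξ 0, ξ 0, by simp, ?_, ?_⟩
    · simp [he ξ hξ]
    · intro t
      rw [hs]
      ring
  · intro hsep
    obtain ⟨ξ, h1, h2⟩ := hsep j k hjk
    exact h2 (he ξ h1)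
end

section
/- Let S_kappa = {0, ..., kappa} and let phi_ms^kappa be the multi-species exclusion interaction on S_kappa. Let j, k in S_kappa with j != k, and let tilde-phi be an interaction on S_kappa containing phi_ms^kappa such that ((j, j), (k, k)) is an edge of tilde-phi and dim_R Consv^{tilde-phi}(S_kappa) = kappa - 1. Then (S_kappa, tilde-phi) is weakly equivalent to the multi-species exclusion interaction (S_{kappa-1}, phi_ms^{kappa-1}) on S_{kappa-1} = {0, ..., kappa-1}, via the injection iota : S_{kappa-1} -> S_kappa given by iota(i) = i for i < k and iota(i) = i + 1 for i >= k. -/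
open Relation

universe u

/-- with `κ + 1` playing the role of the paper's `κ`: the interaction
`tphi ⊇ φ_ms^{κ+1}` on `S_{κ+1} = {0, …, κ+1}` with the diagonal edge `(j,j) ↔ (k,k)` and
`dim Consv = κ` is weakly equivalent to `φ_ms^κ` on `S_κ = {0, …, κ}` via the injection
`ι(i) = i` for `i < k` and `ι(i) = i + 1` for `i ≥ k`. -/
theorem stmt8 (κ : ℕ) (j k : Fin (κ + 1 + 1)) (hjk : j ≠ k)
    (tphi : Set ((Fin (κ + 1 + 1) × Fin (κ + 1 + 1)) × (Fin (κ + 1 + 1) × Fin (κ + 1 + 1))))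
    (hφ : IsInteraction tphi) (hms : msExcl (κ + 1) ⊆ tphi)
    (hedge : ((j, j), (k, k)) ∈ tphi) (hdim : cdim tphi = κ) :
    WeakEquivVia (msExcl κ) tphi
      (fun i : Fin (κ + 1) => if (i : ℕ) < (k : ℕ) then i.castSucc else i.succ) := by
  set ι : Fin (κ + 1) → Fin (κ + 1 + 1) :=
    fun i => if (i : ℕ) < (k : ℕ) then i.castSucc else i.succ with hι
  have hιs : ι = k.succAbove := by
    funext i
    simp only [hι, Fin.succAbove, Fin.lt_def, Fin.val_castSucc]
  have hinj : Function.Injective ι := hιs ▸ Fin.succAbove_right_injective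
  have hsurj : ∀ s, s ≠ k → ∃ i, ι i = s := by
    intro s hs
    rw [hιs]
    exact Fin.exists_succAbove_eq hs
  have hne : ∀ i, ι i ≠ k := by
    intro i
    rw [hιs]
    exact Fin.succAbove_ne k i
  have hV : ∀ ξ, IsConserved tphi ξ → ξ j = ξ k := by
    intro ξ h
    have := h _ hedge
    simp only at this
    linarith
  have hex : ∀ s : Fin (κ + 1 + 1), ∃ i, ι i = if s = k then j else s := by
    intro s
    by_cases h : s = k
    · simpa [h] using hsurj j hjk
    · simpa [h] using hsurj s h
  choose ι' hι' using hex
  have hback : ∀ ξ, IsConserved tphi ξ → ∀ s, ξ (ι (ι' s)) = ξ s := by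
    intro ξ h s
    rw [hι']
    split_ifs with hs
    · rw [hs, hV ξ h]
    · rfl
  let L : consvSubmodule tphi →ₗ[ℝ] (Fin (κ + 1) → ℝ) :=
    (LinearMap.funLeft ℝ ℝ ι).comp (consvSubmodule tphi).subtype
  have hLinj : Function.Injective L := by
    intro a b hab
    apply Subtype.ext
    funext s
    rw [← hback a.1 a.2 s, ← hback b.1 b.2 s]
    exact congrFun hab (ι' s)
  have hfr : κ + 1 ≤ Module.finrank ℝ (consvSubmodule tphi) := by
    have h1 := Submodule.finrank_quotient_add_finrank
      ((constSubmodule (Fin (κ + 1 + 1))).comap (consvSubmodule tphi).subtype)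
    have h2 : Module.finrank ℝ (ConsvQuot tphi) = κ := hdim
    let one : consvSubmodule tphi := ⟨fun _ => 1, fun p _ => rfl⟩
    have hone : one ∈ (constSubmodule (Fin (κ + 1 + 1))).comap (consvSubmodule tphi).subtype :=
      fun a b => rfl
    have h3 : 0 < Module.finrank ℝ
        ((constSubmodule (Fin (κ + 1 + 1))).comap (consvSubmodule tphi).subtype) := by
      apply Submodule.one_le_finrank_iff.mpr
      intro hbot
      rw [hbot, Submodule.mem_bot] at hone
      have h4 : (fun _ => 1 : Fin (κ + 1 + 1) → ℝ) = 0 := congrArg Subtype.val hone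
      exact one_ne_zero (congrFun h4 0)
    have h5 := h1.symm.trans (congrArg (· + _) h2)
    omega
  have hLsurj : Function.Surjective L := by
    have h1 : Module.finrank ℝ (consvSubmodule tphi) = Module.finrank ℝ (Fin (κ + 1) → ℝ) := by
      apply le_antisymm (LinearMap.finrank_le_finrank_of_injective hLinj)
      simpa using hfr
    exact (LinearMap.injective_iff_surjective_of_finrank_eq_finrank h1).mp hLinj
  refine ⟨ι', ?_, ?_, ?_, ?_⟩
  · rintro ξ - p ⟨a, b, -, rfl⟩
    exact add_comm _ _
  · intro ξ _
    obtain ⟨η, hη⟩ := hLsurj ξ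
    have : (fun s' => ξ (ι' s')) = η.1 := by
      funext s
      rw [← hback η.1 η.2 s, ← hη]
      rfl
    rw [this]
    exact η.2
  · intro ξ _
    refine ⟨0, fun s => ?_⟩
    have : ι' (ι s) = s := hinj (by rw [hι', if_neg (hne s)])
    rw [this, add_zero]
  · intro ξ h
    exact ⟨0, fun s => by rw [hback ξ h, add_zero]⟩
end

section
/- Let S_kappa = {0, ..., kappa} and phi_ms^kappa the multi-species exclusion interaction on S_kappa. Let j, k, l in S_kappa with j != k. Let phi' be an interaction containing phi_ms^kappa with edge ((j, l), (k, l)) and dim_R Consv^{phi'}(S_kappa) = kappa - 1, and let tilde-phi be an interaction containing phi_ms^kappa with edge ((j, j), (k, k)) and dim_R Consv^{tilde-phi}(S_kappa) = kappa - 1. Then (S_kappa, phi') is equivalent to (S_kappa, tilde-phi); in particular, (S_kappa, phi') is weakly equivalent to the multi-species exclusion interaction (S_{kappa-1}, phi_ms^{kappa-1}) on {0, ..., kappa-1}. -/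
open Relation

universe u

theorem conserved_iff_aux (κ : ℕ) (j k : Fin (κ + 1 + 1)) (hjk : j ≠ k)
    (φ : Set ((Fin (κ + 1 + 1) × Fin (κ + 1 + 1)) × (Fin (κ + 1 + 1) × Fin (κ + 1 + 1))))
    (h : ∀ ξ, IsConserved φ ξ → ξ j = ξ k) (hd : cdim φ = κ)
    (ξ : Fin (κ + 1 + 1) → ℝ) : IsConserved φ ξ ↔ ξ j = ξ k := by
  refine ⟨h ξ, fun hξ => ?_⟩
  let f : (Fin (κ + 1 + 1) → ℝ) →ₗ[ℝ] ℝ := LinearMap.proj (R := ℝ) (φ := fun _ => ℝ) j - LinearMap.proj (R := ℝ) (φ := fun _ => ℝ) k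
  have hle : consvSubmodule φ ≤ LinearMap.ker f := by
    intro η hη
    simp only [f, LinearMap.mem_ker, LinearMap.sub_apply, LinearMap.proj_apply]
    exact sub_eq_zero.2 (h η hη)
  have hsurj : Function.Surjective f := by
    intro c
    refine ⟨Pi.single j c, ?_⟩
    simp [f, hjk.symm]
  have hker : Module.finrank ℝ (LinearMap.ker f) = κ + 1 := by
    have h1 := LinearMap.finrank_range_add_finrank_ker f
    rw [LinearMap.range_eq_top.2 hsurj] at h1
    simp at h1
    omega
  let N := (constSubmodule (Fin (κ + 1 + 1))).comap (consvSubmodule φ).subtype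
  have hq : Module.finrank ℝ (ConsvQuot φ) + Module.finrank ℝ N
      = Module.finrank ℝ (consvSubmodule φ) := Submodule.finrank_quotient_add_finrank N
  have hN : 0 < Module.finrank ℝ N := by
    have hc : (fun _ => 1 : Fin (κ + 1 + 1) → ℝ) ∈ consvSubmodule φ := fun p _ => rfl
    have hne : N ≠ ⊥ := by
      intro hb
      have hm : (⟨_, hc⟩ : consvSubmodule φ) ∈ N := fun a b => rfl
      rw [hb, Submodule.mem_bot] at hm
      have h2 := congrFun (congrArg Subtype.val hm) j
      simp at h2
    exact Nat.pos_of_ne_zero fun h0 => hne (Submodule.finrank_eq_zero.1 h0)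
  have heq : consvSubmodule φ = LinearMap.ker f := by
    apply Submodule.eq_of_le_of_finrank_le hle
    unfold cdim at hd
    omega
  have hm : ξ ∈ LinearMap.ker f := by
    simp only [f, LinearMap.mem_ker, LinearMap.sub_apply, LinearMap.proj_apply]
    exact sub_eq_zero.2 hξ
  rw [← heq] at hm
  exact hm

/-- with `κ + 1` playing the role of the paper's `κ`: the interaction with
edge `(j,l) ↔ (k,l)` added to `φ_ms^{κ+1}` is equivalent to the one with the diagonal edge
`(j,j) ↔ (k,k)` added; in particular it is weakly equivalent to `φ_ms^κ` on `{0, …, κ}`. -/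
theorem stmt9 (κ : ℕ) (j k l : Fin (κ + 1 + 1)) (hjk : j ≠ k)
    (phi' tphi :
      Set ((Fin (κ + 1 + 1) × Fin (κ + 1 + 1)) × (Fin (κ + 1 + 1) × Fin (κ + 1 + 1))))
    (h1 : IsInteraction phi') (h1ms : msExcl (κ + 1) ⊆ phi')
    (h1edge : ((j, l), (k, l)) ∈ phi') (h1dim : cdim phi' = κ)
    (h2 : IsInteraction tphi) (h2ms : msExcl (κ + 1) ⊆ tphi)
    (h2edge : ((j, j), (k, k)) ∈ tphi) (h2dim : cdim tphi = κ) :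
    InteractionEquiv phi' tphi ∧ WeakEquiv phi' (msExcl κ) := by
  have c1 := conserved_iff_aux κ j k hjk phi' (fun ξ hξ => by
    have := hξ _ h1edge
    simp only at this
    linarith) h1dim
  have c2 := conserved_iff_aux κ j k hjk tphi (fun ξ hξ => by
    have := hξ _ h2edge
    simp only at this
    linarith) h2dim
  have c3 : ∀ ξ : Fin (κ + 1) → ℝ, IsConserved (msExcl κ) ξ := by
    rintro ξ p ⟨a, b, _, rfl⟩
    exact add_comm _ _
  refine ⟨⟨Equiv.refl _, fun ξ hξ => (c1 _).2 ((c2 _).1 hξ),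
    fun ξ hξ => (c2 _).2 ((c1 _).1 hξ)⟩, ?_⟩
  have hex : ∀ s : Fin (κ + 1 + 1), ∃ y, k.succAbove y = if s = k then j else s := by
    intro s
    apply Fin.exists_succAbove_eq
    split_ifs with hs
    · exact hjk
    · exact hs
  choose ι hι using hex
  refine ⟨ι, k.succAbove, fun ξ _ => (c1 _).2 ?_, fun ξ _ => c3 _, fun ξ hξ => ⟨0, fun s => ?_⟩,
    fun ξ _ => ⟨0, fun s => ?_⟩⟩
  · have : ι j = ι k := by
      apply Fin.succAbove_right_injective (p := k)
      rw [hι, hι]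
      simp [hjk]
    simp only [this]
  · rw [hι, add_zero]
    split_ifs with hs
    · rw [hs]
      exact (c1 _).1 hξ
    · rfl
  · have : ι (k.succAbove s) = s := by
      apply Fin.succAbove_right_injective (p := k)
      rw [hι, if_neg (Fin.succAbove_ne k s)]
    rw [this, add_zero]
end

section
/- Let S = {0, 1, 2}. There are exactly 4 equivalence classes of interactions on S, represented by: (1) the multi-species exclusion interaction phi_ms^2, with c_phi = 2 and Consv spanned by the standard basis xi^1, xi^2; (2) the class of interactions with c_phi = 1 whose space of conserved quantities is spanned by xi^1 + xi^2 (weakly equivalent to the multi-species exclusion interaction on {0,1}); (3) the 2-exclusion interaction, with c_phi = 1 and Consv spanned by xi^1 + 2 xi^2; (4) the class with c_phi = 0, containing the interaction whose graph on S x S is complete. Classes (1) and (3) are separable, while (2) and (4) are not. -/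
open Relation

universe u

/-- representative of class (2) -/
def phB : Set ((Fin 3 × Fin 3) × (Fin 3 × Fin 3)) :=
  {q | q = ((1, 1), (2, 2)) ∨ q = ((2, 2), (1, 1))}

/-- the elementary constraints -/
def TC (c : Fin 3 × Bool) (ξ : Fin 3 → ℝ) : Prop :=
  if c.2 then 2 * ξ c.1 = ξ (c.1 + 1) + ξ (c.1 + 2) else ξ (c.1 + 1) = ξ (c.1 + 2)

theorem f3a : (1 : Fin 3) + 1 = 2 := rfl
theorem f3b : (1 : Fin 3) + 2 = 0 := rfl
theorem f3c : (2 : Fin 3) + 1 = 0 := rfl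
theorem f3d : (2 : Fin 3) + 2 = 1 := rfl

theorem TC_two (c c' : Fin 3 × Bool) (h : c ≠ c') (ξ : Fin 3 → ℝ) (h1 : TC c ξ)
    (h2 : TC c' ξ) : ξ 1 = ξ 0 ∧ ξ 2 = ξ 0 := by
  obtain ⟨i, b⟩ := c
  obtain ⟨j, b'⟩ := c'
  fin_cases i <;> fin_cases j <;> cases b <;> cases b' <;>
    simp [TC, f3a, f3b, f3c, f3d] at h h1 h2 <;> constructor <;> linarith

theorem edge_kind (p : (Fin 3 × Fin 3) × (Fin 3 × Fin 3)) :
    (∀ ξ : Fin 3 → ℝ, ξ p.1.1 + ξ p.1.2 = ξ p.2.1 + ξ p.2.2) ∨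
    ∃ c, ∀ ξ : Fin 3 → ℝ, (ξ p.1.1 + ξ p.1.2 = ξ p.2.1 + ξ p.2.2) ↔ TC c ξ := by
  obtain ⟨⟨a, b⟩, ⟨c, d⟩⟩ := p
  fin_cases a <;> fin_cases b <;> fin_cases c <;> fin_cases d <;>
  first
  | (left; intro ξ; simp; done)
  | (left; intro ξ; simp; ring; done)
  | (right; refine ⟨(0, false), fun ξ => ?_⟩; simp [TC] <;> constructor <;> intro h <;> linarith)
  | (right; refine ⟨(1, false), fun ξ => ?_⟩; simp [TC, f3a, f3b] <;> constructor <;> intro h <;> linarith)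
  | (right; refine ⟨(2, false), fun ξ => ?_⟩; simp [TC, f3c, f3d] <;> constructor <;> intro h <;> linarith)
  | (right; refine ⟨(0, true), fun ξ => ?_⟩; simp [TC] <;> constructor <;> intro h <;> linarith)
  | (right; refine ⟨(1, true), fun ξ => ?_⟩; simp [TC, f3a, f3b] <;> constructor <;> intro h <;> linarith)
  | (right; refine ⟨(2, true), fun ξ => ?_⟩; simp [TC, f3c, f3d] <;> constructor <;> intro h <;> linarith)

theorem classify (φ : Set ((Fin 3 × Fin 3) × (Fin 3 × Fin 3))) :
    (∀ ξ, IsConserved φ ξ) ∨ (∃ c, ∀ ξ, IsConserved φ ξ ↔ TC c ξ) ∨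
    (∀ ξ, IsConserved φ ξ ↔ (ξ 1 = ξ 0 ∧ ξ 2 = ξ 0)) := by
  by_cases hA : ∀ p ∈ φ, ∀ ξ : Fin 3 → ℝ, ξ p.1.1 + ξ p.1.2 = ξ p.2.1 + ξ p.2.2
  · exact Or.inl fun ξ p hp => hA p hp ξ
  right
  push Not at hA
  obtain ⟨p, hp, ξ0, h0⟩ := hA
  obtain ⟨c, hc⟩ := (edge_kind p).resolve_left (fun h => h0 (h ξ0))
  by_cases hB : ∀ q ∈ φ, ∀ ξ : Fin 3 → ℝ, TC c ξ → ξ q.1.1 + ξ q.1.2 = ξ q.2.1 + ξ q.2.2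
  · exact Or.inl ⟨c, fun ξ => ⟨fun h => (hc ξ).1 (h p hp), fun h q hq => hB q hq ξ h⟩⟩
  right
  push Not at hB
  obtain ⟨q, hq, ξ1, h1, h2⟩ := hB
  obtain ⟨c', hc'⟩ := (edge_kind q).resolve_left (fun h => h2 (h ξ1))
  have hne : c ≠ c' := by
    rintro rfl
    exact h2 ((hc' ξ1).2 h1)
  intro ξ
  constructor
  · intro h
    exact TC_two c c' hne ξ ((hc ξ).1 (h p hp)) ((hc' ξ).1 (h q hq))
  · rintro ⟨e1, e2⟩ r hr
    have : ∀ t, ξ t = ξ 0 := by intro t; fin_cases t <;> simp [e1, e2]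
    rw [this r.1.1, this r.1.2, this r.2.1, this r.2.2]

theorem ms_cons (ξ : Fin 3 → ℝ) : IsConserved (msExcl 2) ξ := by
  rintro p ⟨j, k, -, rfl⟩
  exact add_comm _ _

theorem B_cons (ξ : Fin 3 → ℝ) : IsConserved phB ξ ↔ ξ 1 = ξ 2 := by
  constructor
  · intro h
    have := h ((1, 1), (2, 2)) (Or.inl rfl)
    simp at this
    linarith
  · rintro h p (rfl | rfl) <;> simp [h]

theorem ex_cons (ξ : Fin 3 → ℝ) : IsConserved (exclK 2) ξ ↔ 2 * ξ 1 = ξ 0 + ξ 2 := by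
  constructor
  · intro h
    have := h ((1, 1), (0, 2)) ⟨1, 1, by decide, by decide, Or.inl rfl⟩
    simp at this
    linarith
  · rintro h p ⟨j, k, hj, hk, hp⟩
    fin_cases j <;> fin_cases k <;> simp at hj hk <;>
      rcases hp with rfl | rfl <;> simp [f3a, show (2 : Fin 3) - 1 = 1 from rfl] <;> linarith

theorem un_cons (ξ : Fin 3 → ℝ) :
    IsConserved (Set.univ : Set ((Fin 3 × Fin 3) × (Fin 3 × Fin 3))) ξ ↔
      (ξ 1 = ξ 0 ∧ ξ 2 = ξ 0) := by
  constructor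
  · intro h
    have h1 := h ((1, 1), (0, 0)) trivial
    have h2 := h ((2, 2), (0, 0)) trivial
    simp at h1 h2
    constructor <;> linarith
  · rintro ⟨e1, e2⟩ r hr
    have : ∀ t, ξ t = ξ 0 := by intro t; fin_cases t <;> simp [e1, e2]
    rw [this r.1.1, this r.1.2, this r.2.1, this r.2.2]

theorem const_iff (ξ : Fin 3 → ℝ) : IsConstFn ξ ↔ (ξ 1 = ξ 0 ∧ ξ 2 = ξ 0) := by
  constructor
  · intro h
    exact ⟨h _ _, h _ _⟩
  · rintro ⟨e1, e2⟩ r s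
    have : ∀ t, ξ t = ξ 0 := by intro t; fin_cases t <;> simp [e1, e2]
    rw [this r, this s]

theorem cdim_eq (φ : Set ((Fin 3 × Fin 3) × (Fin 3 × Fin 3))) (n : ℕ)
    (g : (Fin 3 → ℝ) →ₗ[ℝ] (Fin n → ℝ))
    (hs : ∀ v, ∃ ξ, IsConserved φ ξ ∧ g ξ = v)
    (hk : ∀ ξ, IsConserved φ ξ → (g ξ = 0 ↔ IsConstFn ξ)) : cdim φ = n := by
  have hsur : Function.Surjective (g ∘ₗ (consvSubmodule φ).subtype) := by
    intro v
    obtain ⟨ξ, h1, h2⟩ := hs v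
    exact ⟨⟨ξ, h1⟩, h2⟩
  have hker : (constSubmodule (Fin 3)).comap (consvSubmodule φ).subtype
      = LinearMap.ker (g ∘ₗ (consvSubmodule φ).subtype) := by
    ext ⟨ξ, h⟩
    exact (hk ξ h).symm
  have := ((Submodule.quotEquivOfEq _ _ hker).trans
    (LinearMap.quotKerEquivOfSurjective _ hsur)).finrank_eq
  unfold cdim ConsvQuot
  rw [this]
  simp

/-- coordinate projection -/
abbrev pr (i : Fin 3) : (Fin 3 → ℝ) →ₗ[ℝ] ℝ := LinearMap.proj i

theorem fin3_all (P : Fin 3 → Prop) : (∀ t, P t) ↔ P 0 ∧ P 1 ∧ P 2 := by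
  rw [Fin.forall_fin_succ, Fin.forall_fin_two]; rfl

theorem equivB (φ : Set ((Fin 3 × Fin 3) × (Fin 3 × Fin 3))) (i : Fin 3)
    (h : ∀ ξ, IsConserved φ ξ ↔ TC (i, false) ξ) : InteractionEquiv φ phB := by
  refine ⟨Equiv.subRight i, fun ξ hξ => ?_, fun ξ hξ => ?_⟩
  · rw [B_cons] at hξ
    rw [h]
    simpa [TC] using hξ
  · rw [h] at hξ
    rw [B_cons]
    simpa [TC, add_comm] using hξ

theorem equivX (φ : Set ((Fin 3 × Fin 3) × (Fin 3 × Fin 3))) (i : Fin 3)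
    (h : ∀ ξ, IsConserved φ ξ ↔ TC (i, true) ξ) : InteractionEquiv φ (exclK 2) := by
  refine ⟨Equiv.subRight (i - 1), fun ξ hξ => ?_, fun ξ hξ => ?_⟩
  · rw [ex_cons] at hξ
    rw [h]
    fin_cases i <;> simp [TC, f3a, f3b, f3c, f3d] <;>
      (try simp [show (-1 : Fin 3) = 2 from rfl, show (2 : Fin 3) - 1 = 1 from rfl, show (0 : Fin 3) - 1 = 2 from rfl, show (1 : Fin 3) - 2 = 2 from rfl, f3a, f3b, f3c, f3d]) <;> linarith
  · rw [h] at hξ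
    rw [ex_cons]
    fin_cases i <;> simp [TC, f3a, f3b, f3c, f3d] at hξ ⊢ <;>
      (try simp [show (-1 : Fin 3) = 2 from rfl, show (2 : Fin 3) - 1 = 1 from rfl, show (0 : Fin 3) - 1 = 2 from rfl, show (1 : Fin 3) - 2 = 2 from rfl, f3a, f3b, f3c, f3d]) <;> linarith

theorem sep_equiv (φ φ' : Set ((Fin 3 × Fin 3) × (Fin 3 × Fin 3)))
    (h : InteractionEquiv φ φ') : SeparableInteraction φ ↔ SeparableInteraction φ' := by
  obtain ⟨e, h1, h2⟩ := h
  constructor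
  · intro hs s s' hne
    obtain ⟨ξ, ha, hb⟩ := hs (e.symm s) (e.symm s') (by simpa using hne)
    exact ⟨_, h2 ξ ha, hb⟩
  · intro hs s s' hne
    obtain ⟨ξ, ha, hb⟩ := hs (e s) (e s') (by simpa using hne)
    exact ⟨_, h1 ξ ha, hb⟩

theorem ms_sep : SeparableInteraction (msExcl 2) := by
  intro s s' h
  refine ⟨fun t => if t = s then 1 else 0, ms_cons _, ?_⟩
  simp [h.symm]

theorem B_nsep : ¬ SeparableInteraction phB := by
  intro h
  obtain ⟨ξ, h1, h2⟩ := h 1 2 (by decide)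
  exact h2 ((B_cons ξ).1 h1)

theorem ex_sep : SeparableInteraction (exclK 2) := by
  intro s s' h
  refine ⟨fun t => ((t : ℕ) : ℝ), ?_, ?_⟩
  · rw [ex_cons]; simp
  · intro h'
    simp only [Nat.cast_inj] at h'
    exact h (Fin.ext h')

theorem un_nsep : ¬ SeparableInteraction (Set.univ : Set ((Fin 3 × Fin 3) × (Fin 3 × Fin 3))) := by
  intro h
  obtain ⟨ξ, h1, h2⟩ := h 1 0 (by decide)
  exact h2 ((un_cons ξ).1 h1).1

/-- there are exactly 4 equivalence classes of interactions on
`S = {0, 1, 2}`, with representatives and conserved quantities as listed. -/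
theorem stmt11 :
    ∃ phiB : Set ((Fin 3 × Fin 3) × (Fin 3 × Fin 3)),
      -- (1) the multi-species exclusion interaction
      (IsInteraction (msExcl 2) ∧ cdim (msExcl 2) = 2 ∧
        (∀ ξ : Fin 3 → ℝ, IsConserved (msExcl 2) ξ ↔
          ∃ a b c : ℝ, ∀ t, ξ t = a * stdXi 2 1 t + b * stdXi 2 2 t + c) ∧
        SeparableInteraction (msExcl 2)) ∧
      -- (2) the class with c_φ = 1 and Consv spanned by ξ¹ + ξ²
      (IsInteraction phiB ∧ cdim phiB = 1 ∧
        (∀ ξ : Fin 3 → ℝ, IsConserved phiB ξ ↔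
          ∃ a c : ℝ, ∀ t, ξ t = a * (stdXi 2 1 t + stdXi 2 2 t) + c) ∧
        WeakEquiv phiB (msExcl 1) ∧ ¬ SeparableInteraction phiB) ∧
      -- (3) the 2-exclusion interaction
      (IsInteraction (exclK 2) ∧ cdim (exclK 2) = 1 ∧
        (∀ ξ : Fin 3 → ℝ, IsConserved (exclK 2) ξ ↔
          ∃ a c : ℝ, ∀ t, ξ t = a * (stdXi 2 1 t + 2 * stdXi 2 2 t) + c) ∧
        SeparableInteraction (exclK 2)) ∧
      -- (4) the complete graph
      (IsInteraction (Set.univ : Set ((Fin 3 × Fin 3) × (Fin 3 × Fin 3))) ∧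
        cdim (Set.univ : Set ((Fin 3 × Fin 3) × (Fin 3 × Fin 3))) = 0 ∧
        ¬ SeparableInteraction (Set.univ : Set ((Fin 3 × Fin 3) × (Fin 3 × Fin 3)))) ∧
      -- the four classes are pairwise distinct
      (¬ InteractionEquiv (msExcl 2) phiB ∧ ¬ InteractionEquiv (msExcl 2) (exclK 2) ∧
        ¬ InteractionEquiv (msExcl 2)
            (Set.univ : Set ((Fin 3 × Fin 3) × (Fin 3 × Fin 3))) ∧
        ¬ InteractionEquiv phiB (exclK 2) ∧
        ¬ InteractionEquiv phiB (Set.univ : Set ((Fin 3 × Fin 3) × (Fin 3 × Fin 3))) ∧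
        ¬ InteractionEquiv (exclK 2)
            (Set.univ : Set ((Fin 3 × Fin 3) × (Fin 3 × Fin 3)))) ∧
      -- every interaction on {0,1,2} is equivalent to one of the four
      (∀ φ : Set ((Fin 3 × Fin 3) × (Fin 3 × Fin 3)), IsInteraction φ →
        (InteractionEquiv φ (msExcl 2) ∨ InteractionEquiv φ phiB ∨
          InteractionEquiv φ (exclK 2) ∨
          InteractionEquiv φ (Set.univ : Set ((Fin 3 × Fin 3) × (Fin 3 × Fin 3))))) := by
  refine ⟨phB, ⟨?_, ?_, ?_, ms_sep⟩, ⟨?_, ?_, ?_, ?_, B_nsep⟩, ⟨?_, ?_, ?_, ex_sep⟩,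
    ⟨?_, ?_, un_nsep⟩, ⟨?_, ?_, ?_, ?_, ?_, ?_⟩, ?_⟩
  · rintro p ⟨j, k, h, rfl⟩
    exact ⟨k, j, h.symm, rfl⟩
  · refine cdim_eq _ 2 (LinearMap.pi ![pr 1 - pr 0,
      pr 2 - pr 0]) (fun v => ?_) (fun ξ _ => ?_)
    · refine ⟨![0, v 0, v 1], ms_cons _, ?_⟩
      ext i
      fin_cases i <;> simp [pr]
    · rw [const_iff, funext_iff, Fin.forall_fin_two]
      simp [pr, sub_eq_zero]
  · intro ξ
    refine ⟨fun _ => ⟨ξ 1 - ξ 0, ξ 2 - ξ 0, ξ 0, ?_⟩, fun _ => ms_cons ξ⟩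
    rw [fin3_all]
    simp [stdXi]
  · rintro p (rfl | rfl)
    · exact Or.inr rfl
    · exact Or.inl rfl
  · refine cdim_eq _ 1 (LinearMap.pi ![pr 1 - pr 0])
      (fun v => ?_) (fun ξ h => ?_)
    · refine ⟨![0, v 0, v 0], (B_cons _).2 (by simp), ?_⟩
      ext i
      fin_cases i; simp [pr]
    · rw [B_cons] at h
      rw [const_iff, funext_iff, Fin.forall_fin_one]
      simp [pr, sub_eq_zero, h]
  · intro ξ
    rw [B_cons]
    constructor
    · intro h
      refine ⟨ξ 1 - ξ 0, ξ 0, ?_⟩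
      rw [fin3_all]
      simp [stdXi, h]
    · rintro ⟨a, c, h⟩
      rw [h 1, h 2]
      simp [stdXi]
  · have hm : ∀ ξ : Fin 2 → ℝ, IsConserved (msExcl 1) ξ := by
      rintro ξ p ⟨j, k, -, rfl⟩
      exact add_comm _ _
    refine ⟨![0, 1, 1], ![0, 1], fun ξ _ => (B_cons _).2 (by simp), fun ξ _ => hm _,
      fun ξ h => ⟨0, ?_⟩, fun ξ _ => ⟨0, ?_⟩⟩
    · rw [B_cons] at h
      rw [fin3_all]
      simp [h]
    · refine Fin.forall_fin_two.2 ?_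
      simp
  · rintro p ⟨j, k, h1, h2, rfl | rfl⟩
    · exact ⟨j, k, h1, h2, Or.inr rfl⟩
    · exact ⟨j, k, h1, h2, Or.inl rfl⟩
  · refine cdim_eq _ 1 (LinearMap.pi ![pr 1 - pr 0])
      (fun v => ?_) (fun ξ h => ?_)
    · refine ⟨![0, v 0, 2 * v 0], (ex_cons _).2 (by simp), ?_⟩
      ext i
      fin_cases i; simp [pr]
    · rw [ex_cons] at h
      rw [const_iff, funext_iff, Fin.forall_fin_one]
      simp only [pr, LinearMap.pi_apply, Matrix.cons_val_zero, LinearMap.sub_apply,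
        LinearMap.proj_apply, Pi.zero_apply, sub_eq_zero]
      exact ⟨fun h1 => ⟨h1, by linarith⟩, fun h1 => h1.1⟩
  · intro ξ
    rw [ex_cons]
    constructor
    · intro h
      refine ⟨ξ 1 - ξ 0, ξ 0, ?_⟩
      rw [fin3_all]
      simp [stdXi]
      linarith
    · rintro ⟨a, c, h⟩
      rw [h 0, h 1, h 2]
      simp [stdXi]
      ring
  · intro p _
    trivial
  · refine cdim_eq _ 0 0 (fun v => ⟨0, (un_cons _).2 (by simp), Subsingleton.elim _ _⟩)
      (fun ξ h => ?_)
    rw [un_cons] at h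
    rw [const_iff]
    simp [h]
  · exact fun h => B_nsep ((sep_equiv _ _ h).1 ms_sep)
  · rintro ⟨e, -, h⟩
    have := h (fun t => if t = e.symm 1 then 1 else 0) (ms_cons _)
    rw [ex_cons] at this
    simp at this
  · exact fun h => un_nsep ((sep_equiv _ _ h).1 ms_sep)
  · exact fun h => B_nsep ((sep_equiv _ _ h).2 ex_sep)
  · rintro ⟨e, -, h⟩
    have := h (fun t => if t = 0 then 1 else 0) ((B_cons _).2 (by simp))
    have := (const_iff _).2 ((un_cons _).1 this) (e 0) (e 1)
    simp at this
  · exact fun h => un_nsep ((sep_equiv _ _ h).1 ex_sep)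
  · intro φ _
    rcases classify φ with h | ⟨⟨i, b⟩, h⟩ | h
    · exact Or.inl ⟨Equiv.refl _, fun ξ _ => h _, fun ξ _ => ms_cons _⟩
    · cases b
      · exact Or.inr (Or.inl (equivB φ i h))
      · exact Or.inr (Or.inr (Or.inl (equivX φ i h)))
    · refine Or.inr (Or.inr (Or.inr ⟨Equiv.refl _, fun ξ hξ => ?_, fun ξ hξ => ?_⟩))
      · exact (h _).2 ((un_cons _).1 hξ)
      · exact (un_cons _).2 ((h _).1 hξ)
end

section
/- Let S = {0, 1, 2, 3}. Every interaction on S that is not separable is weakly equivalent to an interaction on {0, 1, 2}. Conversely, every interaction on {0, 1, 2} is weakly equivalent to an interaction on S that is not separable. -/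
open Relation

universe u

/-- every non-separable interaction on `{0,1,2,3}` is weakly equivalent to
an interaction on `{0,1,2}`, and every interaction on `{0,1,2}` is weakly equivalent to a
non-separable interaction on `{0,1,2,3}`. -/
theorem stmt12 :
    (∀ φ : Set ((Fin 4 × Fin 4) × (Fin 4 × Fin 4)), IsInteraction φ →
      ¬ SeparableInteraction φ →
      ∃ ψ : Set ((Fin 3 × Fin 3) × (Fin 3 × Fin 3)), IsInteraction ψ ∧ WeakEquiv φ ψ) ∧
    (∀ ψ : Set ((Fin 3 × Fin 3) × (Fin 3 × Fin 3)), IsInteraction ψ →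
      ∃ φ : Set ((Fin 4 × Fin 4) × (Fin 4 × Fin 4)), IsInteraction φ ∧
        ¬ SeparableInteraction φ ∧ WeakEquiv φ ψ) := by
  constructor
  · intro φ hφ hns
    unfold SeparableInteraction at hns
    push Not at hns
    obtain ⟨s, s', hne, h⟩ := hns
    obtain ⟨y, hy⟩ := Fin.exists_succAbove_eq (Ne.symm hne)
    have key : ∀ t : Fin 4, ∃ x : Fin 3, (t = s ∧ x = y) ∨ s.succAbove x = t := by
      intro t
      by_cases ht : t = s
      · exact ⟨y, Or.inl ⟨ht, rfl⟩⟩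
      · obtain ⟨x, hx⟩ := Fin.exists_succAbove_eq ht
        exact ⟨x, Or.inr hx⟩
    choose ι hι using key
    have hid : ∀ x, ι (s.succAbove x) = x := by
      intro x
      rcases hι (s.succAbove x) with h1 | h1
      · exact absurd h1.1 (Fin.succAbove_ne s x)
      · exact Fin.succAbove_right_injective h1
    have hξ : ∀ ξ : Fin 4 → ℝ, IsConserved φ ξ → ∀ t, ξ (s.succAbove (ι t)) = ξ t := by
      intro ξ hc t
      rcases hι t with h1 | h1
      · rw [h1.2, h1.1, hy, h ξ hc]
      · rw [h1]
    refine ⟨{q | ∃ p ∈ φ, q = ((ι p.1.1, ι p.1.2), (ι p.2.1, ι p.2.2))}, ?_, ι,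
      s.succAbove, ?_, ?_, ?_, ?_⟩
    · rintro _ ⟨p, hp, rfl⟩
      exact ⟨_, hφ p hp, rfl⟩
    · intro ξ hc p hp
      exact hc _ ⟨p, hp, rfl⟩
    · rintro ξ hc _ ⟨p, hp, rfl⟩
      simp only [hξ ξ hc]
      exact hc p hp
    · intro ξ hc
      exact ⟨0, fun t => by rw [hξ ξ hc, add_zero]⟩
    · intro ξ hc
      exact ⟨0, fun t => by rw [hid, add_zero]⟩
  · intro ψ hψ
    obtain ⟨ι, h3, hid⟩ : ∃ ι : Fin 4 → Fin 3, ι 3 = 0 ∧ ∀ x : Fin 3, ι x.castSucc = x :=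
      ⟨![0, 1, 2, 0], rfl, by decide⟩
    let φ : Set ((Fin 4 × Fin 4) × (Fin 4 × Fin 4)) :=
      {q | ((ι q.1.1, ι q.1.2), (ι q.2.1, ι q.2.2)) ∈ ψ ∨
        (ι q.1.1, ι q.1.2) = (ι q.2.1, ι q.2.2)}
    have h0 : ι 0 = 0 := hid 0
    have h30 : ∀ ξ : Fin 4 → ℝ, IsConserved φ ξ → ξ 3 = ξ 0 := by
      intro ξ hc
      have := hc ((3, 0), (0, 0)) (Or.inr (by simp [h3, h0]))
      simpa using this
    have hξ : ∀ ξ : Fin 4 → ℝ, IsConserved φ ξ → ∀ t, ξ (ι t).castSucc = ξ t := by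
      intro ξ hc t
      induction t using Fin.lastCases with
      | last =>
        change ξ (ι 3).castSucc = ξ 3
        rw [h3, h30 ξ hc]; rfl
      | cast x => rw [hid]
    refine ⟨φ, ?_, ?_, ι, Fin.castSucc, ?_, ?_, ?_, ?_⟩
    · rintro p (hp | hp)
      · exact Or.inl (hψ _ hp)
      · exact Or.inr hp.symm
    · intro hs
      obtain ⟨ξ, hc, hne⟩ := hs 3 0 (by decide)
      exact hne (h30 ξ hc)
    · rintro ξ hc p (hp | hp)
      · exact hc _ hp
      · rw [Prod.mk.injEq] at hp
        simp only [hp.1, hp.2]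
    · intro ξ hc p hp
      exact hc ((p.1.1.castSucc, p.1.2.castSucc), (p.2.1.castSucc, p.2.2.castSucc))
        (Or.inl (by simpa only [hid] using hp))
    · intro ξ hc
      exact ⟨0, fun t => by rw [hξ ξ hc, add_zero]⟩
    · intro ξ hc
      exact ⟨0, fun t => by rw [hid, add_zero]⟩
end

section
/- Let (S, phi) be an exchangeable interaction and (X, E) a connected symmetric directed graph. Then for any configuration eta in S^X and any x, y in X, the configuration eta^{x,y} obtained from eta by swapping its components at x and y lies in the same connected component of (S^X, Phi_E) as eta. More generally, if sigma : X -> X is a bijection fixing all but finitely many vertices and eta^sigma is defined by (eta^sigma)_z = eta_{sigma(z)}, then eta and eta^sigma lie in the same connected component of (S^X, Phi_E). -/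
open Relation

universe u

theorem aux_edge {S X : Type*} [DecidableEq X] (φ : Set ((S × S) × (S × S)))
    (E : Set (X × X)) (x y : X) (hxy : x ≠ y) (he : (x, y) ∈ E) (η : X → S) (p q : S × S)
    (h : graphConn φ p q) (h1 : η x = p.1) (h2 : η y = p.2) :
    configConn φ E η (fun z => if z = x then q.1 else if z = y then q.2 else η z) := by
  induction h with
  | refl =>
    have : (fun z => if z = x then p.1 else if z = y then p.2 else η z) = η := by
      funext z
      split_ifs with ha hb
      · rw [ha, h1]
      · rw [hb, h2]
      · rfl
    rw [this]
    exact Relation.ReflTransGen.refl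
  | tail _ hbc ih =>
    refine Relation.ReflTransGen.tail ih ⟨(x, y), he, ?_, ?_⟩
    · simpa [hxy.symm] using hbc
    · intro z hz1 hz2
      simp only at hz1 hz2
      simp [hz1, hz2]

theorem aux_swap_edge {S X : Type*} [DecidableEq X] (φ : Set ((S × S) × (S × S)))
    (hex : ExchangeableInteraction φ) (E : Set (X × X)) (x y : X) (he : (x, y) ∈ E)
    (η : X → S) : configConn φ E η (fun z => η (Equiv.swap x y z)) := by
  by_cases hxy : x = y
  · subst hxy
    simp only [Equiv.swap_self, Equiv.refl_apply]
    exact Relation.ReflTransGen.refl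
  · have := aux_edge φ E x y hxy he η _ _ (hex (η x) (η y)) rfl rfl
    convert this using 2 with z
    rw [Equiv.swap_apply_def]
    split_ifs <;> rfl

theorem aux_mul {S X : Type*} (φ : Set ((S × S) × (S × S))) (E : Set (X × X))
    (σ τ : Equiv.Perm X) (h1 : ∀ η : X → S, configConn φ E η (fun z => η (σ z)))
    (h2 : ∀ η : X → S, configConn φ E η (fun z => η (τ z))) (η : X → S) :
    configConn φ E η (fun z => η ((σ * τ) z)) :=
  Relation.ReflTransGen.trans (h1 η) (h2 (fun z => η (σ z)))

theorem aux_swap {S X : Type*} [DecidableEq X] (φ : Set ((S × S) × (S × S)))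
    (hex : ExchangeableInteraction φ) (E : Set (X × X)) (x y : X) (h : graphConn E x y) :
    ∀ η : X → S, configConn φ E η (fun z => η (Equiv.swap x y z)) := by
  induction h with
  | refl =>
    intro η
    simp only [Equiv.swap_self, Equiv.refl_apply]
    exact Relation.ReflTransGen.refl
  | @tail c d _ hcd ih =>
    have hs := aux_swap_edge φ hex E c d hcd
    by_cases hc : x = c
    · subst hc; exact hs
    by_cases hd : x = d
    · subst hd
      intro η
      simp only [Equiv.swap_self, Equiv.refl_apply]
      exact Relation.ReflTransGen.refl
    have := Equiv.swap_mul_swap_mul_swap hc hd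
    rw [Equiv.swap_comm x d, ← this]
    exact aux_mul φ E _ _ (aux_mul φ E _ _ hs ih) hs

theorem aux_symm {S X : Type*} (φ : Set ((S × S) × (S × S))) (hφ : IsInteraction φ)
    (E : Set (X × X)) (η η' : X → S) (h : configConn φ E η η') : configConn φ E η' η := by
  induction h with
  | refl => exact Relation.ReflTransGen.refl
  | tail _ hbc ih =>
    obtain ⟨e, he, h1, h2⟩ := hbc
    exact Relation.ReflTransGen.head ⟨e, he, hφ _ h1, fun z a b => (h2 z a b).symm⟩ ih

/-- for an exchangeable interaction and a connected symmetric graph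
`(X, E)`, swapping two components of a configuration, and more generally permuting
finitely many components, stays within the same connected component of `(S^X, Φ_E)`. -/
theorem stmt15 {S X : Type*} [DecidableEq X] (φ : Set ((S × S) × (S × S)))
    (hφ : IsInteraction φ) (hex : ExchangeableInteraction φ)
    (E : Set (X × X)) (hE : IsSymmGraph E) (hconn : ∀ a b : X, graphConn E a b) :
    (∀ (η : X → S) (x y : X), configConn φ E η (fun z => η (Equiv.swap x y z))) ∧
    (∀ (η : X → S) (σ : Equiv.Perm X), {z | σ z ≠ z}.Finite →
      configConn φ E η (fun z => η (σ z))) := by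
  have hsw : ∀ (x y : X) (η : X → S), configConn φ E η (fun z => η (Equiv.swap x y z)) :=
    fun x y => aux_swap φ hex E x y (hconn x y)
  refine ⟨fun η x y => hsw x y η, fun η σ hσ => ?_⟩
  have hmem : σ ∈ Subgroup.closure {τ : Equiv.Perm X | τ.IsSwap} :=
    mem_closure_isSwap'.2 hσ
  revert η
  refine Subgroup.closure_induction (p := fun τ _ => ∀ η : X → S,
    configConn φ E η (fun z => η (τ z))) ?_ ?_ ?_ ?_ hmem
  · rintro τ ⟨x, y, _, rfl⟩
    exact hsw x y
  · intro η
    exact Relation.ReflTransGen.refl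
  · intro a b _ _ ha hb
    exact aux_mul φ E a b ha hb
  · intro a _ ha η
    have := ha (fun z => η (a⁻¹ z))
    simp at this
    exact aux_symm φ hφ E _ _ this
end
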